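/- arXiv:2211.10367 — 3 statements merged into one kernel-verified Lean document; each statement's English description precedes it below -/
import Mathlib

section
/- Let n ≥ 1 and let G be a transitive subgroup of the symmetric group S_n acting on {1, ..., n}. Suppose G contains exactly m transpositions of the form (1 i), i.e. m is the number of points i ≠ 1 such that the transposition (1 i) lies in G. Then m + 1 divides n. -/
/-- Let `n ≥ 1` and let `G` be a transitive subgroup of the symmetric group on `n` points.
If `G` contains exactly `m` transpositions of the form `(1 i)`, then `m + 1 ∣ n`. -/
theorem succ_num_transpositions_dvd (n : ℕ) (hn : 1 ≤ n)
    (G : Subgroup (Equiv.Perm (Fin n)))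
    (htrans : ∀ a b : Fin n, ∃ σ : Equiv.Perm (Fin n), σ ∈ G ∧ σ a = b)
    (m : ℕ)
    (hm : {i : Fin n | i ≠ ⟨0, hn⟩ ∧ Equiv.swap ⟨0, hn⟩ i ∈ G}.ncard = m) :
    m + 1 ∣ n := by
  classical
  let z : Fin n := ⟨0, hn⟩
  let f : Fin n → Finset (Fin n) := fun a => Finset.univ.filter (fun j => Equiv.swap a j ∈ G)
  have hmem : ∀ a j, j ∈ f a ↔ Equiv.swap a j ∈ G := by intro a j; simp [f]
  have hself : ∀ a, a ∈ f a := by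
    intro a
    rw [hmem, Equiv.swap_self]
    exact G.one_mem
  have hsymm : ∀ a b, Equiv.swap a b ∈ G → Equiv.swap b a ∈ G := by
    intro a b h
    rwa [Equiv.swap_comm]
  have htr : ∀ a b c, Equiv.swap a b ∈ G → Equiv.swap b c ∈ G → Equiv.swap a c ∈ G := by
    intro a b c h1 h2
    exact SubmonoidClass.swap_mem_trans G h1 h2
  have hz : (f z).card = m + 1 := by
    have h1 : {i : Fin n | i ≠ ⟨0, hn⟩ ∧ Equiv.swap ⟨0, hn⟩ i ∈ G} = ((f z).erase z : Finset (Fin n)) := by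
      ext i
      simp [f, z, and_comm]
    rw [h1, Set.ncard_coe_finset] at hm
    rw [← hm, Finset.card_erase_add_one (hself z)]
  have hcard : ∀ a, (f a).card = m + 1 := by
    intro a
    obtain ⟨σ, hσ, h⟩ := htrans z a
    rw [← hz, ← Finset.card_map σ.toEmbedding (s := f z)]
    congr 1
    ext j
    rw [Finset.mem_map_equiv, hmem, hmem]
    have key : Equiv.swap a j = σ * Equiv.swap z (σ.symm j) * σ⁻¹ := by
      rw [← Equiv.swap_apply_apply, h, Equiv.apply_symm_apply]
    rw [key, G.mul_mem_cancel_right (G.inv_mem hσ), G.mul_mem_cancel_left hσ]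
  have hfib : ∀ a b, f b = f a ↔ b ∈ f a := by
    intro a b
    constructor
    · intro h
      rw [← h]
      exact hself b
    · intro h
      rw [hmem] at h
      ext j
      rw [hmem, hmem]
      exact ⟨htr _ _ _ h, htr _ _ _ (hsymm _ _ h)⟩
  have hsum := Finset.card_eq_sum_card_image f (Finset.univ : Finset (Fin n))
  rw [Finset.card_univ, Fintype.card_fin] at hsum
  rw [hsum]
  refine Finset.dvd_sum ?_
  intro b hb
  obtain ⟨a, -, rfl⟩ := Finset.mem_image.mp hb
  have : (Finset.univ.filter (fun x => f x = f a)) = f a := by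
    ext j
    simp only [Finset.mem_filter, Finset.mem_univ, true_and]
    exact hfib a j
  rw [this, hcard]
end

section
/- Let n ≥ 1 and let G be a transitive subgroup of the symmetric group S_n acting on {1, ..., n}. Suppose G contains exactly m transpositions of the form (1 i), and set n' = n / (m + 1). Let H be the subgroup of G generated by all transpositions contained in G. Then H is isomorphic, as a group, to the direct product of n' copies of the symmetric group S_{m+1}. -/
theorem aux_pi_iso {α Q : Type*} (f : α → Q) (H : Subgroup (Equiv.Perm α))
    (hH : ∀ σ, σ ∈ H ↔ ∀ x, f (σ x) = f x) :
    Nonempty ((∀ q : Q, Equiv.Perm {a // f a = q}) ≃* H) := by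
  let φ : (∀ q : Q, Equiv.Perm {a // f a = q}) →* Equiv.Perm α :=
    (Equiv.sigmaFiberEquiv f).permCongrHom.toMonoidHom.comp (Equiv.Perm.sigmaCongrRightHom _)
  have hφ : ∀ g x, φ g x = (g (f x) ⟨x, rfl⟩ : α) := by
    intro g x; rfl
  have key : ∀ g q (y : {a // f a = q}), φ g y = (g q y : α) := by
    rintro g q ⟨y, rfl⟩; rfl
  have hmem : ∀ g, φ g ∈ H := by
    intro g
    rw [hH]
    intro x
    rw [hφ]
    exact (g (f x) ⟨x, rfl⟩).2
  refine ⟨MulEquiv.ofBijective (φ.codRestrict H hmem) ⟨?_, ?_⟩⟩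
  · intro g g' h
    have h' : φ g = φ g' := congrArg Subtype.val h
    funext q
    ext y
    rw [← key, ← key, h']
  · rintro ⟨σ, hσ⟩
    have h1 := (hH σ).1 hσ
    refine ⟨fun q => σ.subtypePerm (fun x => by rw [h1]), ?_⟩
    apply Subtype.ext
    ext x
    exact hφ _ x

/-- Let `n ≥ 1` and let `G` be a transitive subgroup of the symmetric group on `n` points
containing exactly `m` transpositions of the form `(1 i)`, and set `n' = n / (m + 1)`.
Then the subgroup `H` of `G` generated by all transpositions contained in `G` is isomorphic
to the direct product of `n'` copies of the symmetric group `S_{m+1}`. -/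
theorem transposition_subgroup_iso_product (n : ℕ) (hn : 1 ≤ n)
    (G : Subgroup (Equiv.Perm (Fin n)))
    (htrans : ∀ a b : Fin n, ∃ σ : Equiv.Perm (Fin n), σ ∈ G ∧ σ a = b)
    (m : ℕ)
    (hm : {i : Fin n | i ≠ ⟨0, hn⟩ ∧ Equiv.swap ⟨0, hn⟩ i ∈ G}.ncard = m)
    (n' : ℕ) (hn' : n' = n / (m + 1))
    (H : Subgroup (Equiv.Perm (Fin n)))
    (hH : H = Subgroup.closure {σ : Equiv.Perm (Fin n) | σ ∈ G ∧ σ.IsSwap}) :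
    Nonempty (H ≃* (Fin n' → Equiv.Perm (Fin (m + 1)))) := by
  classical
  have hS : ∀ f ∈ {σ : Equiv.Perm (Fin n) | σ ∈ G ∧ σ.IsSwap}, f.IsSwap := fun f hf => hf.2
  have hHG : H ≤ G := by
    rw [hH, Subgroup.closure_le]
    exact fun f hf => hf.1
  have hswap : ∀ x y, Equiv.swap x y ∈ H ↔ Equiv.swap x y ∈ G := by
    intro x y
    refine ⟨fun h => hHG h, fun h => ?_⟩
    by_cases hxy : x = y
    · subst hxy
      rw [Equiv.swap_self]
      exact H.one_mem
    · rw [hH]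
      exact Subgroup.subset_closure ⟨h, x, y, hxy, rfl⟩
  let s : Setoid (Fin n) :=
    { r := fun x y => Equiv.swap x y ∈ G
      iseqv := 
        { refl := fun x => by
            rw [Equiv.swap_self]
            exact G.one_mem
          symm := fun {x y} h => by rwa [Equiv.swap_comm]
          trans := fun {x y z} h h' => SubmonoidClass.swap_mem_trans G h h' } }
  let f : Fin n → Quotient s := Quotient.mk s
  have hf : ∀ x y, f x = f y ↔ Equiv.swap x y ∈ G := fun x y => Quotient.eq
  have hHf : ∀ σ, σ ∈ H ↔ ∀ x, f (σ x) = f x := by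
    intro σ
    have h1 : ∀ x, f (σ x) = f x ↔ σ x ∈ MulAction.orbit H x := by
      intro x
      rw [hf, ← hswap]
      subst hH
      exact swap_mem_closure_isSwap hS
    simp only [h1]
    subst hH
    rw [mem_closure_isSwap hS]
    exact ⟨fun h => h.2, fun h => ⟨Set.toFinite _, h⟩⟩
  have hconj : ∀ σ ∈ G, ∀ x y, Equiv.swap x y ∈ G → Equiv.swap (σ x) (σ y) ∈ G := by
    intro σ hσ x y h
    rw [Equiv.swap_apply_apply]
    exact G.mul_mem (G.mul_mem hσ h) (G.inv_mem hσ)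
  have hcard0 : Nat.card {a // f a = f ⟨0, hn⟩} = m + 1 := by
    have : {a | f a = f ⟨0, hn⟩} =
        insert ⟨0, hn⟩ {i : Fin n | i ≠ ⟨0, hn⟩ ∧ Equiv.swap ⟨0, hn⟩ i ∈ G} := by
      ext a
      by_cases ha : a = ⟨0, hn⟩
      · simp [ha]
      · simp [ha, hf, Equiv.swap_comm]
    rw [← hm, ← Set.ncard_insert_of_notMem (a := ⟨0, hn⟩) (by simp), ← this]
    rfl
  have hcard : ∀ q, Nat.card {a // f a = q} = m + 1 := by
    intro q
    obtain ⟨b, rfl⟩ := Quotient.exists_rep q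
    obtain ⟨σ, hσ, hb⟩ := htrans ⟨0, hn⟩ b
    rw [← hcard0]
    refine (Nat.card_congr (σ.subtypeEquiv fun a => ?_)).symm
    change f a = f _ ↔ f (σ a) = f b
    rw [hf, hf, ← hb]
    refine ⟨hconj σ hσ _ _, fun h => ?_⟩
    simpa using hconj _ (G.inv_mem hσ) _ _ h
  have hQ : Nat.card (Quotient s) = n' := by
    have h1 := Nat.card_congr (Equiv.sigmaFiberEquiv f)
    rw [Nat.card_sigma] at h1
    simp only [hcard] at h1
    simp only [Finset.sum_const, Finset.card_univ, smul_eq_mul, Nat.card_fin] at h1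
    rw [Nat.card_eq_fintype_card, hn']
    exact (Nat.div_eq_of_eq_mul_left (Nat.succ_pos m) h1.symm).symm
  obtain ⟨e⟩ := aux_pi_iso f H hHf
  let e1 : ∀ q, {a // f a = q} ≃ Fin (m + 1) := fun q => Finite.equivFinOfCardEq (hcard q)
  let e2 : Quotient s ≃ Fin n' := Finite.equivFinOfCardEq hQ
  exact ⟨e.symm.trans ((MulEquiv.piCongrRight fun q => (e1 q).permCongrHom).trans
    (MulEquiv.arrowCongr e2 (MulEquiv.refl _)))⟩
end

section
/- Let n ≥ 1 and let G be a transitive subgroup of the symmetric group S_n acting on {1, ..., n}. Suppose G contains exactly m transpositions of the form (1 i), and set n' = n / (m + 1). Let H be the subgroup of G generated by all transpositions contained in G (a normal subgroup of G). Then there exists an injective group homomorphism from the quotient group G / H into the symmetric group S_{n'}. -/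
theorem qe_swap_rel_trans {α : Type*} [DecidableEq α] (G : Subgroup (Equiv.Perm α)) {a b c : α}
    (h1 : Equiv.swap a b ∈ G) (h2 : Equiv.swap b c ∈ G) : Equiv.swap a c ∈ G := by
  by_cases hab : a = b
  · subst hab; exact h2
  by_cases hac : a = c
  · subst hac; simp [← Equiv.Perm.one_def, G.one_mem]
  have key : Equiv.swap b c * Equiv.swap a b * Equiv.swap b c = Equiv.swap a c := by
    rw [Equiv.swap_mul_swap_mul_swap hab hac, Equiv.swap_comm]
  rw [← key]
  exact G.mul_mem (G.mul_mem h2 h1) h2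

/-- Points are related when the transposition exchanging them lies in `G`. -/
def qeSetoid {α : Type*} [DecidableEq α] (G : Subgroup (Equiv.Perm α)) : Setoid α where
  r a b := Equiv.swap a b ∈ G
  iseqv := ⟨fun a => by simp [← Equiv.Perm.one_def, G.one_mem],
    fun {a b} h => by rwa [Equiv.swap_comm], fun h1 h2 => qe_swap_rel_trans G h1 h2⟩

theorem qe_conj {α : Type*} [DecidableEq α] (G : Subgroup (Equiv.Perm α)) {σ : Equiv.Perm α}
    (hσ : σ ∈ G) (a b : α) : Equiv.swap a b ∈ G ↔ Equiv.swap (σ a) (σ b) ∈ G := by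
  have e : Equiv.swap (σ a) (σ b) = σ * Equiv.swap a b * σ⁻¹ := by
    rw [Equiv.mul_swap_eq_swap_mul, mul_assoc, mul_inv_cancel, mul_one]
  rw [e, Subgroup.mul_mem_cancel_right _ (G.inv_mem hσ), Subgroup.mul_mem_cancel_left _ hσ]

/-- The action of `G` on the classes. -/
def qeHom {α : Type*} [DecidableEq α] (G : Subgroup (Equiv.Perm α)) :
    G →* Equiv.Perm (Quotient (qeSetoid G)) where
  toFun g := Quotient.congr g.1 (fun a b => qe_conj G g.2 a b)
  map_one' := by
    ext x; induction x using Quotient.inductionOn; rfl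
  map_mul' g h := by
    ext x; induction x using Quotient.inductionOn; rfl

theorem qe_ker {α : Type*} [DecidableEq α] [Finite α] (G : Subgroup (Equiv.Perm α)) (g : G) :
    qeHom G g = 1 ↔
      g.1 ∈ Subgroup.closure {σ : Equiv.Perm α | σ ∈ G ∧ σ.IsSwap} := by
  have h0 : qeHom G g = 1 ↔ ∀ x, Equiv.swap (g.1 x) x ∈ G := by
    constructor
    · intro h x
      have := congrArg (fun e => e (Quotient.mk (qeSetoid G) x)) h
      exact Quotient.exact this
    · intro h
      ext x
      induction x using Quotient.inductionOn with
      | h x => exact Quotient.sound (h x)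
  rw [h0]
  constructor
  · intro h
    rw [mem_closure_isSwap (fun f hf => hf.2)]
    refine ⟨Set.toFinite _, fun x => ?_⟩
    by_cases hx : g.1 x = x
    · rw [hx]; exact MulAction.mem_orbit_self x
    · exact ⟨⟨Equiv.swap (g.1 x) x, Subgroup.subset_closure ⟨h x, _, _, hx, rfl⟩⟩,
        Equiv.swap_apply_right _ _⟩
  · intro h x
    obtain ⟨g, hg⟩ := g
    simp only at h ⊢
    clear h0 hg
    induction h using Subgroup.closure_induction generalizing x with
    | mem σ hσ =>
      obtain ⟨hG, a, b, hab, rfl⟩ := hσ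
      rcases eq_or_ne x a with rfl | hxa
      · rw [Equiv.swap_apply_left, Equiv.swap_comm]; exact hG
      rcases eq_or_ne x b with rfl | hxb
      · rw [Equiv.swap_apply_right]; exact hG
      rw [Equiv.swap_apply_of_ne_of_ne hxa hxb]
      simp [← Equiv.Perm.one_def, G.one_mem]
    | one => simp [← Equiv.Perm.one_def, G.one_mem]
    | mul σ τ hσ hτ h1 h2 =>
      exact qe_swap_rel_trans G (h1 (τ x)) (h2 x)
    | inv σ hσ h1 =>
      have := h1 (σ⁻¹ x)
      rw [Equiv.swap_comm]
      simpa using this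

theorem qe_card (n : ℕ) (hn : 1 ≤ n) (G : Subgroup (Equiv.Perm (Fin n)))
    (htrans : ∀ a b : Fin n, ∃ σ : Equiv.Perm (Fin n), σ ∈ G ∧ σ a = b) (m : ℕ)
    (hm : {i : Fin n | i ≠ ⟨0, hn⟩ ∧ Equiv.swap ⟨0, hn⟩ i ∈ G}.ncard = m) :
    Nat.card (Quotient (qeSetoid G)) * (m + 1) = n := by
  classical
  have h0 : {i : Fin n | Equiv.swap ⟨0, hn⟩ i ∈ G}.ncard = m + 1 := by
    rw [← hm, ← Set.ncard_insert_of_notMem (a := (⟨0, hn⟩ : Fin n)) (by simp)]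
    congr 1
    ext i
    by_cases hi : i = ⟨0, hn⟩
    · subst hi; simp [← Equiv.Perm.one_def, G.one_mem]
    · simp [hi]
  have hf : ∀ q : Quotient (qeSetoid G),
      Nat.card {x // Quotient.mk (qeSetoid G) x = q} = m + 1 := by
    intro q
    induction q using Quotient.inductionOn with
    | h a =>
      obtain ⟨σ, hσ, rfl⟩ := htrans ⟨0, hn⟩ a
      rw [← h0, ← Nat.card_coe_set_eq]
      refine (Nat.card_congr (Equiv.subtypeEquiv σ fun i => ?_)).symm
      rw [Set.mem_ofPred_eq, qe_conj G hσ, Equiv.swap_comm]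
      exact (Quotient.eq (r := qeSetoid G)).symm
  have := Nat.card_congr (Equiv.sigmaFiberEquiv (Quotient.mk (qeSetoid G)))
  have := Fintype.ofFinite (Quotient (qeSetoid G))
  rw [Nat.card_sigma] at *
  simp_all

/-- Let `n ≥ 1` and let `G` be a transitive subgroup of the symmetric group on `n` points
containing exactly `m` transpositions of the form `(1 i)`, and set `n' = n / (m + 1)`.
Let `H` be the (normal) subgroup of `G` generated by all transpositions contained in `G`.
Then the quotient `G / H` embeds into the symmetric group `S_{n'}`. -/
theorem quotient_embeds_in_symmetric_group (n : ℕ) (hn : 1 ≤ n)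
    (G : Subgroup (Equiv.Perm (Fin n)))
    (htrans : ∀ a b : Fin n, ∃ σ : Equiv.Perm (Fin n), σ ∈ G ∧ σ a = b)
    (m : ℕ)
    (hm : {i : Fin n | i ≠ ⟨0, hn⟩ ∧ Equiv.swap ⟨0, hn⟩ i ∈ G}.ncard = m)
    (n' : ℕ) (hn' : n' = n / (m + 1))
    (H : Subgroup (Equiv.Perm (Fin n)))
    (hH : H = Subgroup.closure {σ : Equiv.Perm (Fin n) | σ ∈ G ∧ σ.IsSwap})
    [hnorm : (H.subgroupOf G).Normal] :
    ∃ φ : G ⧸ H.subgroupOf G →* Equiv.Perm (Fin n'), Function.Injective φ := by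
  subst hH
  have hc := qe_card n hn G htrans m hm
  have hc' : Nat.card (Quotient (qeSetoid G)) = n' := by
    rw [hn']
    exact (Nat.div_eq_of_eq_mul_left (Nat.succ_pos m) hc.symm).symm
  let e := (Equiv.permCongrHom (Finite.equivFinOfCardEq hc')).toMonoidHom
  have he : Function.Injective e := MulEquiv.injective _
  refine ⟨e.comp (QuotientGroup.lift _ (qeHom G) fun g hg => (qe_ker G g).2 hg), ?_⟩
  rw [MonoidHom.coe_comp]
  refine he.comp ?_
  rw [injective_iff_map_eq_one]
  intro x
  induction x using QuotientGroup.induction_on with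
  | H g =>
    intro h
    rw [QuotientGroup.eq_one_iff]
    exact (qe_ker G g).1 h
end
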